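/- Let X be a Polish space. For all Borel probability measures P, Q on X, d_TV(P,Q) ≤ d_PC(P,Q) ≤ 2·d_TV(P,Q)/(1 + d_TV(P,Q)). Moreover, if the union of the topological supports of P and Q contains at most 2 points, then d_PC(P,Q) = d_TV(P,Q). -/

import Mathlib

open MeasureTheory ENNReal

noncomputable section

open Classical in
/-- The Poisson coupling distance between two Borel probability measures `P, Q`:
with `μ := P + Q`, `f := dP/dμ`, `g := dQ/dμ`,
`d_PC(P,Q) = 1 − ∫ (∫ max {f(y)/f(x), g(y)/g(x)} μ(dy))⁻¹ μ(dx)`,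
where the outer integrand is declared to be `0` at points with `f(x) = 0` or
`g(x) = 0` (and `ℝ≥0∞`-division gives `a/0 = ∞` for `a > 0`). -/
def dPC {X : Type*} [MeasurableSpace X] (P Q : Measure X) : ℝ :=
  1 - (∫⁻ x,
      (if P.rnDeriv (P + Q) x = 0 ∨ Q.rnDeriv (P + Q) x = 0 then 0 else
        (∫⁻ y, max (P.rnDeriv (P + Q) y / P.rnDeriv (P + Q) x)
            (Q.rnDeriv (P + Q) y / Q.rnDeriv (P + Q) x) ∂(P + Q))⁻¹)
      ∂(P + Q)).toReal

/-- The total variation distance `d_TV(P,Q) = sup_{A Borel} |P(A) − Q(A)|`. -/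
def dTV {X : Type*} [MeasurableSpace X] (P Q : Measure X) : ℝ :=
  ⨆ A : {A : Set X // MeasurableSet A}, |(P A.1).toReal - (Q A.1).toReal|

/-- The topological support of a measure: the set of points all of whose open
neighborhoods have positive measure. -/
def msupport {X : Type*} [TopologicalSpace X] [MeasurableSpace X] (μ : Measure X) : Set X :=
  {x : X | ∀ U : Set X, IsOpen U → x ∈ U → 0 < μ U}

section PoissonCoupling

variable {X : Type*} [MeasurableSpace X] (P Q : Measure X)

/-- The mass `∫ min (f, g) dμ` shared by `P` and `Q`, where `μ = P + Q`. -/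
def overlap : ℝ≥0∞ :=
  ∫⁻ x, min (P.rnDeriv (P + Q) x) (Q.rnDeriv (P + Q) x) ∂(P + Q)

open Classical in
/-- The integrand of the outer integral in `dPC`. -/
def couplingDensity (x : X) : ℝ≥0∞ :=
  if P.rnDeriv (P + Q) x = 0 ∨ Q.rnDeriv (P + Q) x = 0 then 0 else
    (∫⁻ y, max (P.rnDeriv (P + Q) y / P.rnDeriv (P + Q) x)
      (Q.rnDeriv (P + Q) y / Q.rnDeriv (P + Q) x) ∂(P + Q))⁻¹

theorem dPC_eq : dPC P Q = 1 - (∫⁻ x, couplingDensity P Q x ∂(P + Q)).toReal := rfl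

theorem measure_compl_msupport [TopologicalSpace X] [SecondCountableTopology X] (μ : Measure X) :
    μ (msupport μ)ᶜ = 0 := by
  refine measure_null_of_locally_null _ fun x hx => ?_
  simp only [msupport, Set.mem_compl_iff, Set.mem_ofPred_eq, not_forall, not_lt,
    nonpos_iff_eq_zero] at hx
  obtain ⟨U, hU, hxU, h0⟩ := hx
  exact ⟨U, mem_nhdsWithin_of_mem_nhds (hU.mem_nhds hxU), h0⟩

theorem overlap_eq_add_compl {s : Set X} (hs : MeasurableSet s) :
    overlap P Q =
      ∫⁻ x in s, min (P.rnDeriv (P + Q) x) (Q.rnDeriv (P + Q) x) ∂(P + Q) +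
      ∫⁻ x in sᶜ, min (P.rnDeriv (P + Q) x) (Q.rnDeriv (P + Q) x) ∂(P + Q) :=
  (lintegral_add_compl _ hs).symm

variable [IsProbabilityMeasure P] [IsProbabilityMeasure Q]

theorem setLIntegral_rnDeriv_add_left (s : Set X) :
    ∫⁻ x in s, P.rnDeriv (P + Q) x ∂(P + Q) = P s :=
  Measure.setLIntegral_rnDeriv (Measure.AbsolutelyContinuous.rfl.add_right Q) s

theorem setLIntegral_rnDeriv_add_right (s : Set X) :
    ∫⁻ x in s, Q.rnDeriv (P + Q) x ∂(P + Q) = Q s := by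
  rw [add_comm]
  exact setLIntegral_rnDeriv_add_left Q P s

theorem lintegral_rnDeriv_add_left : ∫⁻ x, P.rnDeriv (P + Q) x ∂(P + Q) = 1 := by
  simpa using setLIntegral_rnDeriv_add_left P Q Set.univ

theorem lintegral_rnDeriv_add_right : ∫⁻ x, Q.rnDeriv (P + Q) x ∂(P + Q) = 1 := by
  simpa using setLIntegral_rnDeriv_add_right P Q Set.univ

theorem overlap_le_one : overlap P Q ≤ 1 :=
  (lintegral_mono fun _ => min_le_left _ _).trans_eq (lintegral_rnDeriv_add_left P Q)

theorem overlap_ne_top : overlap P Q ≠ ∞ :=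
  ne_top_of_le_ne_top one_ne_top (overlap_le_one P Q)

theorem lintegral_max_add_overlap :
    ∫⁻ x, max (P.rnDeriv (P + Q) x) (Q.rnDeriv (P + Q) x) ∂(P + Q) + overlap P Q = 2 := by
  rw [overlap, ← lintegral_add_right _
    ((Measure.measurable_rnDeriv _ _).min (Measure.measurable_rnDeriv _ _))]
  simp_rw [max_add_min]
  rw [lintegral_add_right _ (Measure.measurable_rnDeriv _ _), lintegral_rnDeriv_add_left,
    lintegral_rnDeriv_add_right, one_add_one_eq_two]

theorem overlap_le {s : Set X} (hs : MeasurableSet s) : overlap P Q ≤ P s + Q sᶜ := by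
  rw [overlap_eq_add_compl P Q hs, ← setLIntegral_rnDeriv_add_left P Q s,
    ← setLIntegral_rnDeriv_add_right P Q sᶜ]
  gcongr
  · exact min_le_left _ _
  · exact min_le_right _ _

theorem exists_overlap_eq : ∃ s, MeasurableSet s ∧ overlap P Q = P s + Q sᶜ := by
  have hs : MeasurableSet {x | P.rnDeriv (P + Q) x ≤ Q.rnDeriv (P + Q) x} :=
    measurableSet_le (Measure.measurable_rnDeriv _ _) (Measure.measurable_rnDeriv _ _)
  refine ⟨_, hs, ?_⟩
  rw [overlap_eq_add_compl P Q hs, ← setLIntegral_rnDeriv_add_left P Q,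
    ← setLIntegral_rnDeriv_add_right P Q]
  congr 1
  · exact setLIntegral_congr_fun hs fun x hx => min_eq_left hx
  · exact setLIntegral_congr_fun hs.compl fun x hx => by
      rw [Set.mem_compl_iff, Set.mem_ofPred_eq, not_le] at hx
      exact min_eq_right hx.le

theorem toReal_add_compl {s : Set X} (hs : MeasurableSet s) :
    (P s + Q sᶜ).toReal = 1 - ((Q s).toReal - (P s).toReal) := by
  rw [prob_compl_eq_one_sub hs, toReal_add (measure_ne_top _ _) (by simp),
    toReal_sub_of_le prob_le_one one_ne_top, toReal_one]
  ring

theorem dTV_eq : dTV P Q = 1 - (overlap P Q).toReal := by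
  have key : ∀ s, MeasurableSet s →
      (Q s).toReal - (P s).toReal ≤ 1 - (overlap P Q).toReal := fun s hs => by
    have h := toReal_mono (by finiteness) (overlap_le P Q hs)
    rw [toReal_add_compl P Q hs] at h
    linarith
  have bound : ∀ A : {A : Set X // MeasurableSet A},
      |(P A.1).toReal - (Q A.1).toReal| ≤ 1 - (overlap P Q).toReal := fun ⟨s, hs⟩ => by
    refine abs_le.2 ⟨by linarith [key s hs], ?_⟩
    have h := key sᶜ hs.compl
    rw [prob_compl_eq_one_sub hs, prob_compl_eq_one_sub hs,
      toReal_sub_of_le prob_le_one one_ne_top, toReal_sub_of_le prob_le_one one_ne_top] at h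
    linarith
  have : Nonempty {A : Set X // MeasurableSet A} := ⟨⟨∅, .empty⟩⟩
  refine le_antisymm (ciSup_le bound) ?_
  obtain ⟨s, hs, h⟩ := exists_overlap_eq P Q
  refine le_trans ?_ (le_ciSup ⟨_, Set.forall_mem_range.2 bound⟩ ⟨s, hs⟩)
  rw [h, toReal_add_compl P Q hs]
  linarith [neg_abs_le ((P s).toReal - (Q s).toReal)]

theorem lintegral_rnDeriv_add_left_div (c : ℝ≥0∞) :
    ∫⁻ y, P.rnDeriv (P + Q) y / c ∂(P + Q) = c⁻¹ := by
  simp_rw [div_eq_mul_inv]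
  rw [lintegral_mul_const _ (Measure.measurable_rnDeriv _ _), lintegral_rnDeriv_add_left, one_mul]

theorem lintegral_rnDeriv_add_right_div (c : ℝ≥0∞) :
    ∫⁻ y, Q.rnDeriv (P + Q) y / c ∂(P + Q) = c⁻¹ := by
  rw [add_comm]
  exact lintegral_rnDeriv_add_left_div Q P c

theorem couplingDensity_le (x : X) :
    couplingDensity P Q x ≤ min (P.rnDeriv (P + Q) x) (Q.rnDeriv (P + Q) x) := by
  unfold couplingDensity
  split_ifs with h
  · exact zero_le
  · refine le_min ?_ ?_ <;> rw [ENNReal.inv_le_iff_inv_le]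
    · rw [← lintegral_rnDeriv_add_left_div P Q]
      exact lintegral_mono fun _ => le_max_left _ _
    · rw [← lintegral_rnDeriv_add_right_div P Q]
      exact lintegral_mono fun _ => le_max_right _ _

theorem lintegral_couplingDensity_le : ∫⁻ x, couplingDensity P Q x ∂(P + Q) ≤ overlap P Q :=
  lintegral_mono (couplingDensity_le P Q)

theorem le_couplingDensity (x : X) :
    min (P.rnDeriv (P + Q) x) (Q.rnDeriv (P + Q) x) *
      (∫⁻ y, max (P.rnDeriv (P + Q) y) (Q.rnDeriv (P + Q) y) ∂(P + Q))⁻¹ ≤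
      couplingDensity P Q x := by
  unfold couplingDensity
  split_ifs with h
  · rcases h with h | h <;> simp [h]
  · have hm : min (P.rnDeriv (P + Q) x) (Q.rnDeriv (P + Q) x) ≠ 0 := by
      push Not at h
      exact (lt_min (pos_iff_ne_zero.2 h.1) (pos_iff_ne_zero.2 h.2)).ne'
    have hM : ∫⁻ y, max (P.rnDeriv (P + Q) y) (Q.rnDeriv (P + Q) y) ∂(P + Q) ≠ ∞ := fun h => by
      simpa [h] using lintegral_max_add_overlap P Q
    rw [ENNReal.le_inv_iff_le_inv, ENNReal.mul_inv (.inl hm) (.inr (ENNReal.inv_ne_zero.2 hM)),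
      inv_inv, mul_comm, ← lintegral_mul_const _
        ((Measure.measurable_rnDeriv _ _).max (Measure.measurable_rnDeriv _ _))]
    refine lintegral_mono fun y => max_le ?_ ?_ <;> rw [div_eq_mul_inv] <;> gcongr
    · exact le_max_left _ _
    · exact min_le_left _ _
    · exact le_max_right _ _
    · exact min_le_right _ _

theorem overlap_mul_le_lintegral_couplingDensity :
    overlap P Q * (∫⁻ y, max (P.rnDeriv (P + Q) y) (Q.rnDeriv (P + Q) y) ∂(P + Q))⁻¹ ≤
      ∫⁻ x, couplingDensity P Q x ∂(P + Q) := by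
  rw [overlap, ← lintegral_mul_const _
    ((Measure.measurable_rnDeriv _ _).min (Measure.measurable_rnDeriv _ _))]
  exact lintegral_mono (le_couplingDensity P Q)

theorem forall_le_or_forall_le_of_encard_le_two {α β : Type*} [LinearOrder β] {s : Set α}
    (hs : s.encard ≤ 2) {u v : α → β} {x : α} (hx : x ∈ s) (huv : u x = v x) :
    (∀ y ∈ s, u y ≤ v y) ∨ (∀ y ∈ s, v y ≤ u y) := by
  by_contra! h
  obtain ⟨⟨y, hy, hvu⟩, z, hz, huv'⟩ := h
  have h3 : ({x, y, z} : Set α).encard = 3 := by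
    refine Set.encard_eq_three.2 ⟨x, y, z, ?_, ?_, ?_, rfl⟩
    · rintro rfl
      exact hvu.ne' huv
    · rintro rfl
      exact huv'.ne huv
    · rintro rfl
      exact hvu.asymm huv'
  have hsub : ({x, y, z} : Set α) ⊆ s := by
    simp [Set.insert_subset_iff, hx, hy, hz]
  have := (Set.encard_le_encard hsub).trans hs
  rw [h3] at this
  exact absurd this (by decide)

theorem overlap_le_lintegral_couplingDensity {s : Set X} (hs : s.encard ≤ 2)
    (hμ : (P + Q) sᶜ = 0) : overlap P Q ≤ ∫⁻ x, couplingDensity P Q x ∂(P + Q) := by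
  have hmem : ∀ᵐ x ∂(P + Q), x ∈ s := hμ
  refine lintegral_mono_ae ?_
  filter_upwards [hmem, Measure.rnDeriv_lt_top P (P + Q), Measure.rnDeriv_lt_top Q (P + Q)]
    with x hx hf hg
  unfold couplingDensity
  split_ifs with h
  · rcases h with h | h <;> simp [h]
  · push Not at h
    have hone : P.rnDeriv (P + Q) x / P.rnDeriv (P + Q) x =
        Q.rnDeriv (P + Q) x / Q.rnDeriv (P + Q) x := by
      rw [ENNReal.div_self h.1 hf.ne, ENNReal.div_self h.2 hg.ne]
    rw [ENNReal.le_inv_iff_le_inv]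
    rcases forall_le_or_forall_le_of_encard_le_two hs
      (u := fun y => P.rnDeriv (P + Q) y / P.rnDeriv (P + Q) x)
      (v := fun y => Q.rnDeriv (P + Q) y / Q.rnDeriv (P + Q) x) hx hone with hle | hle
    · calc _ = ∫⁻ y, Q.rnDeriv (P + Q) y / Q.rnDeriv (P + Q) x ∂(P + Q) :=
            lintegral_congr_ae (hmem.mono fun y hy => max_eq_right (hle y hy))
        _ = (Q.rnDeriv (P + Q) x)⁻¹ := lintegral_rnDeriv_add_right_div P Q _
        _ ≤ _ := ENNReal.inv_le_inv.2 (min_le_right _ _)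
    · calc _ = ∫⁻ y, P.rnDeriv (P + Q) y / P.rnDeriv (P + Q) x ∂(P + Q) :=
            lintegral_congr_ae (hmem.mono fun y hy => max_eq_left (hle y hy))
        _ = (P.rnDeriv (P + Q) x)⁻¹ := lintegral_rnDeriv_add_left_div P Q _
        _ ≤ _ := ENNReal.inv_le_inv.2 (min_le_left _ _)

theorem dTV_le_dPC : dTV P Q ≤ dPC P Q := by
  rw [dTV_eq, dPC_eq]
  exact sub_le_sub_left (toReal_mono (overlap_ne_top P Q) (lintegral_couplingDensity_le P Q)) 1

theorem dPC_le : dPC P Q ≤ 2 * dTV P Q / (1 + dTV P Q) := by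
  have hfin : ∫⁻ x, couplingDensity P Q x ∂(P + Q) ≠ ∞ :=
    ne_top_of_le_ne_top (overlap_ne_top P Q) (lintegral_couplingDensity_le P Q)
  have hM : ∫⁻ y, max (P.rnDeriv (P + Q) y) (Q.rnDeriv (P + Q) y) ∂(P + Q) ≠ ∞ := fun h => by
    simpa [h] using lintegral_max_add_overlap P Q
  have hsum := congrArg ENNReal.toReal (lintegral_max_add_overlap P Q)
  rw [toReal_add hM (overlap_ne_top P Q), toReal_ofNat] at hsum
  have h := toReal_mono hfin (overlap_mul_le_lintegral_couplingDensity P Q)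
  rw [toReal_mul, toReal_inv, eq_sub_of_add_eq hsum] at h
  have h1 : (overlap P Q).toReal ≤ 1 := by
    simpa using toReal_mono one_ne_top (overlap_le_one P Q)
  rw [dTV_eq, dPC_eq]
  have hpos : 0 < 2 - (overlap P Q).toReal := by linarith
  rw [← div_eq_mul_inv, div_le_iff₀ hpos] at h
  rw [le_div_iff₀ (by linarith)]
  linarith

theorem dPC_eq_dTV_of_encard_le_two {s : Set X} (hs : s.encard ≤ 2) (hμ : (P + Q) sᶜ = 0) :
    dPC P Q = dTV P Q := by
  rw [dTV_eq, dPC_eq, le_antisymm (lintegral_couplingDensity_le P Q)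
    (overlap_le_lintegral_couplingDensity P Q hs hμ)]

end PoissonCoupling

/-- on a Polish space `X`, for Borel probability measures `P, Q`,
`d_TV(P,Q) ≤ d_PC(P,Q) ≤ 2 d_TV(P,Q) / (1 + d_TV(P,Q))`; moreover if
`supp(P) ∪ supp(Q)` has at most two points, then `d_PC(P,Q) = d_TV(P,Q)`. -/
theorem dTV_le_dPC_le {X : Type*} [TopologicalSpace X] [PolishSpace X]
    [MeasurableSpace X] [BorelSpace X]
    (P Q : Measure X) [IsProbabilityMeasure P] [IsProbabilityMeasure Q] :
    dTV P Q ≤ dPC P Q ∧ dPC P Q ≤ 2 * dTV P Q / (1 + dTV P Q) ∧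
      ((msupport P ∪ msupport Q).encard ≤ 2 → dPC P Q = dTV P Q) := by
  refine ⟨dTV_le_dPC P Q, dPC_le P Q, fun h => dPC_eq_dTV_of_encard_le_two P Q h ?_⟩
  rw [Set.compl_union, Measure.add_apply, add_eq_zero]
  exact ⟨measure_mono_null Set.inter_subset_left (measure_compl_msupport P),
    measure_mono_null Set.inter_subset_right (measure_compl_msupport Q)⟩

end
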